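/- Let p : Ω → (0,∞) be measurable with a measurable partial derivative ∂_g p, such that K₀ := ∫_Ω |∂_g p(v,g)|²/p(v,g) dv dg < ∞ and such that for almost every g > 0 the g-marginal satisfies ∫_0^{V_F} p(v,g) dv = M(g)/Z with Z = ∫_0^∞ M(g') dg'. Then ∫_Ω e^{g²/(8a)}·|∂_g p(v,g)| dv dg ≤ (K₀ · Z^{−1} · ∫_0^∞ e^{g²/(4a)}·M(g) dg)^{1/2}, and the integral ∫_0^∞ e^{g²/(4a)}·M(g) dg is finite. -/

import Mathlib

open Real MeasureTheory Set Filter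

noncomputable section

/-- The Maxwellian `M(g) = exp(-(g - g_in)^2 / (2a))`. -/
def Mw (gin a g : ℝ) : ℝ := Real.exp (-(g - gin) ^ 2 / (2 * a))

theorem Mw_integrable (gin a : ℝ) (ha : 0 < a) : Integrable (fun g => Mw gin a g) := by
  have h := (integrable_exp_neg_mul_sq (b := 1 / (2 * a)) (by positivity)).comp_sub_right gin
  refine h.congr (ae_of_all _ fun g => ?_)
  simp only [Mw]
  congr 1
  field_simp

theorem Mw_weighted_integrable (gin a : ℝ) (ha : 0 < a) :
    Integrable (fun g => Real.exp (g ^ 2 / (4 * a)) * Mw gin a g) := by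
  have h := ((integrable_exp_neg_mul_sq (b := 1 / (4 * a)) (by positivity)).comp_sub_right
    (2 * gin)).const_mul (Real.exp (gin ^ 2 / (2 * a)))
  refine h.congr (ae_of_all _ fun g => ?_)
  simp only [Mw]
  rw [← Real.exp_add, ← Real.exp_add]
  congr 1
  field_simp
  ring

/-- the weighted `L¹` bound on `∂_g p` from the Fisher-type
information and the Gaussian marginal. -/
theorem stmt19 (VF VE gin a : ℝ)
    (hVF : 0 < VF) (hVE : VF < VE) (hgin : 0 < gin) (ha : 0 < a)
    (p : ℝ → ℝ → ℝ)
    (hmeas : Measurable (fun x : ℝ × ℝ => p x.1 x.2))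
    (hmeasd : Measurable (fun x : ℝ × ℝ => deriv (fun g => p x.1 g) x.2))
    (hpos : ∀ v ∈ Ioo 0 VF, ∀ g ∈ Ioi (0:ℝ), 0 < p v g)
    (hK0 : IntegrableOn
      (fun x : ℝ × ℝ => |deriv (fun g => p x.1 g) x.2| ^ 2 / p x.1 x.2)
      ((Ioo 0 VF) ×ˢ (Ioi 0)) volume)
    (hmarg : ∀ᵐ g ∂(volume.restrict (Ioi (0:ℝ))),
      ∫ v in Ioo 0 VF, p v g = Mw gin a g / (∫ g' in Ioi (0:ℝ), Mw gin a g')) :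
    IntegrableOn (fun g => Real.exp (g ^ 2 / (4 * a)) * Mw gin a g) (Ioi 0) volume ∧
    ∫⁻ x in (Ioo (0:ℝ) VF) ×ˢ (Ioi (0:ℝ)),
        ENNReal.ofReal (Real.exp (x.2 ^ 2 / (8 * a)) * |deriv (fun g => p x.1 g) x.2|) ≤
      ENNReal.ofReal (Real.sqrt
        ((∫ x in (Ioo (0:ℝ) VF) ×ˢ (Ioi (0:ℝ)),
            |deriv (fun g => p x.1 g) x.2| ^ 2 / p x.1 x.2) *
          (∫ g' in Ioi (0:ℝ), Mw gin a g')⁻¹ *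
          ∫ g in Ioi (0:ℝ), Real.exp (g ^ 2 / (4 * a)) * Mw gin a g)) := by
  have hMpos : ∀ g, 0 < Mw gin a g := fun g => Real.exp_pos _
  have hW := Mw_weighted_integrable gin a ha
  refine ⟨hW.integrableOn, ?_⟩
  have hZ : 0 < ∫ g' in Ioi (0:ℝ), Mw gin a g' := by
    rw [setIntegral_pos_iff_support_of_nonneg_ae (ae_of_all _ fun g => (hMpos g).le)
      (Mw_integrable gin a ha).integrableOn]
    have : Function.support (fun g => Mw gin a g) = univ := by
      ext g; simpa using (hMpos g).ne'
    rw [this]; simp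
  set Z := ∫ g' in Ioi (0:ℝ), Mw gin a g' with hZdef
  set D : ℝ × ℝ → ℝ := fun x => deriv (fun g => p x.1 g) x.2 with hD
  set S : Set (ℝ × ℝ) := (Ioo (0:ℝ) VF) ×ˢ (Ioi (0:ℝ)) with hS
  have hSm : MeasurableSet S := measurableSet_Ioo.prod measurableSet_Ioi
  have hposS : ∀ x ∈ S, 0 < p x.1 x.2 := fun x hx => hpos _ hx.1 _ hx.2
  set K := ∫ x in S, |D x| ^ 2 / p x.1 x.2 with hK
  set J := ∫ g in Ioi (0:ℝ), Real.exp (g ^ 2 / (4 * a)) * Mw gin a g with hJ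
  have hK' : ∫⁻ x in S, ENNReal.ofReal (|D x| ^ 2 / p x.1 x.2) = ENNReal.ofReal K := by
    rw [hK, ofReal_integral_eq_lintegral_ofReal hK0]
    filter_upwards [ae_restrict_mem hSm] with x hx
    have := hposS x hx
    simp only [Pi.zero_apply]
    positivity
  have hK0' : 0 ≤ K := setIntegral_nonneg hSm fun x hx => by
    have := hposS x hx
    positivity
  have hJ0 : 0 ≤ J := setIntegral_nonneg measurableSet_Ioi fun x _ => by
    have := hMpos x
    positivity
  have hP : ∫⁻ x in S, ENNReal.ofReal (Real.exp (x.2 ^ 2 / (4 * a)) * p x.1 x.2)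
      = ENNReal.ofReal (Z⁻¹ * J) := by
    have hmeas2 : Measurable
        (fun x : ℝ × ℝ => ENNReal.ofReal (Real.exp (x.2 ^ 2 / (4 * a)) * p x.1 x.2)) := by
      fun_prop
    rw [hS, Measure.volume_eq_prod, ← Measure.prod_restrict,
      lintegral_prod_symm _ hmeas2.aemeasurable, hJ, ← integral_const_mul,
      ofReal_integral_eq_lintegral_ofReal (hW.integrableOn.const_mul _)
        (ae_of_all _ fun g => by have := hMpos g; simp only [Pi.zero_apply]; positivity)]
    refine lintegral_congr_ae ?_
    filter_upwards [hmarg, ae_restrict_mem measurableSet_Ioi] with g hg hg0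
    have hne : ∫ v in Ioo 0 VF, p v g ≠ 0 := by
      rw [hg]; exact (div_pos (hMpos g) hZ).ne'
    have hint : IntegrableOn (fun v => p v g) (Ioo 0 VF) := by
      by_contra hc
      exact hne (integral_undef hc)
    rw [← ofReal_integral_eq_lintegral_ofReal (hint.const_mul _)]
    · rw [integral_const_mul, hg]
      congr 1
      ring
    · filter_upwards [ae_restrict_mem measurableSet_Ioo] with v hv
      have := hpos v hv g hg0
      simp only [Pi.zero_apply]
      positivity
  have hH := ENNReal.lintegral_mul_le_Lp_mul_Lq (volume.restrict S) Real.HolderConjugate.two_two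
    (f := fun x => ENNReal.ofReal (|D x| / √(p x.1 x.2)))
    (g := fun x => ENNReal.ofReal (Real.exp (x.2 ^ 2 / (8 * a)) * √(p x.1 x.2)))
    (by fun_prop) (by fun_prop)
  have e1 : ∫⁻ x in S, ENNReal.ofReal (|D x| / √(p x.1 x.2)) ^ (2:ℝ) = ENNReal.ofReal K := by
    rw [← hK']
    refine setLIntegral_congr_fun hSm fun x hx => ?_
    have := hposS x hx
    rw [ENNReal.ofReal_rpow_of_nonneg (by positivity) (by norm_num), Real.rpow_two, div_pow,
      Real.sq_sqrt this.le]
  have e2 : ∫⁻ x in S, ENNReal.ofReal (Real.exp (x.2 ^ 2 / (8 * a)) * √(p x.1 x.2)) ^ (2:ℝ)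
      = ENNReal.ofReal (Z⁻¹ * J) := by
    rw [← hP]
    refine setLIntegral_congr_fun hSm fun x hx => ?_
    have := hposS x hx
    rw [ENNReal.ofReal_rpow_of_nonneg (by positivity) (by norm_num), Real.rpow_two, mul_pow,
      Real.sq_sqrt this.le, ← Real.exp_nat_mul]
    congr 3
    push_cast
    field_simp
    ring
  have e0 : ∫⁻ x in S, ENNReal.ofReal (Real.exp (x.2 ^ 2 / (8 * a)) * |D x|) =
      ∫⁻ x in S, ((fun x : ℝ × ℝ => ENNReal.ofReal (|D x| / √(p x.1 x.2))) *
        (fun x : ℝ × ℝ => ENNReal.ofReal (Real.exp (x.2 ^ 2 / (8 * a)) * √(p x.1 x.2)))) x := by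
    refine setLIntegral_congr_fun hSm fun x hx => ?_
    have := Real.sqrt_pos.2 (hposS x hx)
    simp only [Pi.mul_apply]
    rw [← ENNReal.ofReal_mul (by positivity)]
    congr 1
    field_simp
  rw [e1, e2, ← e0] at hH
  refine hH.trans (le_of_eq ?_)
  have hZJ : 0 ≤ Z⁻¹ * J := by positivity
  rw [ENNReal.ofReal_rpow_of_nonneg hK0' (by norm_num),
    ENNReal.ofReal_rpow_of_nonneg hZJ (by norm_num), ← ENNReal.ofReal_mul (by positivity),
    ← Real.mul_rpow hK0' hZJ, Real.sqrt_eq_rpow, mul_assoc]
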